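/- With H as above (ρ smooth, 0 < ρ' ≤ π/(2k) with equality only at r = R²/2; ζ(N) = 1, ζ(ν) = 9/10 for ν < N), the fixed points of φ_H^{2k} in B^{2N}(R) are exactly z = 0 together with the circle C = { z : |z_N|² = R²/2, z_1 = … = z_{N−1} = 0 }. -/

import Mathlib

open Real

/-- The only angle in `(0, 2π]` with trivial exponential is `2π`. -/
lemma exp_mul_I_eq_one_iff_of_mem_Ioc {θ : ℝ} (hθ : θ ∈ Set.Ioc 0 (2 * π)) :
    Complex.exp (θ * Complex.I) = 1 ↔ θ = 2 * π := by
  constructor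
  · intro h
    obtain ⟨n, hn⟩ := Complex.exp_eq_one_iff.1 h
    have hn' : θ = n * (2 * π) := by
      have := congrArg Complex.im hn
      simpa using this
    obtain ⟨h0, h1⟩ := hθ
    have hn0 : 0 < n := by
      by_contra! hle
      have : (n : ℝ) ≤ 0 := by exact_mod_cast hle
      nlinarith [pi_pos]
    have : (1 : ℝ) ≤ n := by exact_mod_cast hn0
    nlinarith [pi_pos]
  · rintro rfl
    simp

/-- A weighted sum of squared norms supported on a single coordinate. -/
lemma sum_mul_norm_sq_eq_of_forall_ne {ι : Type*} [Fintype ι] (w : ι → ℝ) {z : ι → ℂ} {i : ι}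
    (h : ∀ j, j ≠ i → z j = 0) : ∑ j, w j * ‖z j‖ ^ 2 = w i * ‖z i‖ ^ 2 :=
  Fintype.sum_eq_single i fun j hj => by simp [h j hj]

/-- The fixed points of φ_H^{2k} in B^{2N}(R) are exactly z = 0 together with the
circle C = { z : |z_N|² = R²/2, z_1 = ⋯ = z_{N-1} = 0 }. -/
theorem stmt_12 (N k : ℕ) (hk : 1 ≤ k) (R : ℝ) (hR : 0 < R)
    (ζ : Fin (N + 1) → ℝ) (hζ : ∀ ν, ζ ν = if ν = Fin.last N then 1 else 9 / 10)
    (d : ℝ → ℝ)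
    (hd : ∀ r ∈ Set.Icc 0 (R ^ 2), 0 < d r ∧ d r ≤ π / (2 * k))
    (hd2 : ∀ r ∈ Set.Icc 0 (R ^ 2), (d r = π / (2 * k) ↔ r = R ^ 2 / 2))
    (S : (Fin (N + 1) → ℂ) → ℝ) (hS : ∀ z, S z = ∑ ν, ζ ν * ‖z ν‖ ^ 2)
    (Φ : ℝ → (Fin (N + 1) → ℂ) → (Fin (N + 1) → ℂ))
    (hΦ : ∀ t z ν, Φ t z ν =
      Complex.exp (2 * Complex.I * (ζ ν : ℂ) * (t : ℂ) * (d (S z) : ℂ)) * z ν)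
    (z : Fin (N + 1) → ℂ) (hz : ∑ ν, ‖z ν‖ ^ 2 < R ^ 2) :
    Φ (2 * k) z = z ↔
      (z = 0 ∨ (‖z (Fin.last N)‖ ^ 2 = R ^ 2 / 2 ∧
        ∀ ν : Fin (N + 1), ν ≠ Fin.last N → z ν = 0)) := by
  have hk0 : (0 : ℝ) < k := by exact_mod_cast hk
  have hζ_last : ζ (Fin.last N) = 1 := by simp [hζ]
  have hζ_ne (ν) (hν : ν ≠ Fin.last N) : ζ ν = 9 / 10 := by simp [hζ, hν]
  have hζ_pos (ν) : 0 < ζ ν := by rw [hζ]; split_ifs <;> norm_num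
  have hζ_le (ν) : ζ ν ≤ 1 := by rw [hζ]; split_ifs <;> norm_num
  have hS_mem : S z ∈ Set.Icc 0 (R ^ 2) := by
    rw [hS]
    refine ⟨Finset.sum_nonneg fun ν _ => mul_nonneg (hζ_pos ν).le (sq_nonneg _),
      le_trans (Finset.sum_le_sum fun ν _ => ?_) hz.le⟩
    exact mul_le_of_le_one_left (sq_nonneg _) (hζ_le ν)
  obtain ⟨hd_pos, hd_le⟩ := hd _ hS_mem
  have hd_iff := hd2 _ hS_mem
  have hτ_pos : 0 < 4 * k * d (S z) := by positivity
  have hτ_le : 4 * k * d (S z) ≤ 2 * π := by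
    rw [le_div_iff₀ (by positivity)] at hd_le
    linarith
  have hτ_iff : 4 * k * d (S z) = 2 * π ↔ S z = R ^ 2 / 2 := by
    rw [← hd_iff, eq_div_iff (by positivity)]
    constructor <;> intro h <;> linarith
  have hflow (ν) : Φ (2 * k) z ν = z ν ↔ z ν = 0 ∨ ζ ν * (4 * k * d (S z)) = 2 * π := by
    have hmem : ζ ν * (4 * k * d (S z)) ∈ Set.Ioc 0 (2 * π) :=
      ⟨mul_pos (hζ_pos ν) hτ_pos,
        (mul_le_of_le_one_left hτ_pos.le (hζ_le ν)).trans hτ_le⟩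
    have harg : 2 * Complex.I * (ζ ν : ℂ) * ((2 * k : ℝ) : ℂ) * (d (S z) : ℂ) =
        ((ζ ν * (4 * k * d (S z)) : ℝ) : ℂ) * Complex.I := by
      push_cast
      ring
    rw [hΦ, harg, mul_left_eq_self₀, exp_mul_I_eq_one_iff_of_mem_Ioc hmem, or_comm]
  have hflow_ne (ν) (hν : ν ≠ Fin.last N) : Φ (2 * k) z ν = z ν ↔ z ν = 0 := by
    rw [hflow, hζ_ne ν hν, or_iff_left]
    linarith
  have hflow_last : Φ (2 * k) z (Fin.last N) = z (Fin.last N) ↔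
      z (Fin.last N) = 0 ∨ S z = R ^ 2 / 2 := by
    rw [hflow, hζ_last, one_mul, hτ_iff]
  have hS_eq (h : ∀ ν, ν ≠ Fin.last N → z ν = 0) : S z = ‖z (Fin.last N)‖ ^ 2 := by
    rw [hS, sum_mul_norm_sq_eq_of_forall_ne ζ h, hζ_last, one_mul]
  constructor
  · intro h
    have hne (ν) (hν : ν ≠ Fin.last N) : z ν = 0 := (hflow_ne ν hν).1 (congrFun h ν)
    rcases hflow_last.1 (congrFun h _) with h0 | hr
    · left
      funext ν
      by_cases hν : ν = Fin.last N
      · simpa [hν] using h0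
      · exact hne ν hν
    · exact .inr ⟨(hS_eq hne).symm.trans hr, hne⟩
  · rintro (h0 | ⟨hr, hne⟩)
    · funext ν
      exact (hflow ν).2 (.inl (congrFun h0 ν))
    · funext ν
      by_cases hν : ν = Fin.last N
      · subst hν
        exact hflow_last.2 (.inr ((hS_eq hne).trans hr))
      · exact (hflow_ne ν hν).2 (hne ν hν)
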